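/- arXiv:1208.0508 — 2 statements merged into one kernel-verified Lean document; each statement's English description precedes it below -/
import Mathlib

section
/- Let q = p^e be a prime power with q ≡ 1 (mod 6), and let E_{a,b}: y² = x³ + ax + b be an elliptic curve over F_q with a ≠ 0 and −a/3 a square in F_q. Choose k ∈ F_q with 3k² + a = 0. If T is a generator of the character group of F_q^×, then a_q(E_{a,b}) = −q·T^{(q-1)/2}(−k) · ₂F₁(T^{(q-1)/6}, T^{5(q-1)/6}; ε | −(k³+ak+b)/(4k³)), where ε is the trivial character. -/
open Finset Complex

/-- The root of unity `e^{2πi/p}`. -/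
noncomputable def zetaP (p : ℕ) : ℂ := Complex.exp (2 * Real.pi * Complex.I / p)

lemma zetaP_pow (p : ℕ) (hp : p ≠ 0) : zetaP p ^ p = 1 := by
  rw [zetaP, ← Complex.exp_nat_mul]
  have : (p : ℂ) * (2 * Real.pi * Complex.I / p) = 2 * Real.pi * Complex.I := by
    rw [mul_div_assoc']
    exact mul_div_cancel_left₀ _ (by exact_mod_cast hp)
  rw [this, Complex.exp_two_pi_mul_I]

/-- The canonical additive character `θ(α) = ζ_p^{tr α}` of a finite field of
characteristic `p`. -/
noncomputable def theta (p : ℕ) [hp : Fact p.Prime] (F : Type*) [Field F] [Fintype F]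
    [Algebra (ZMod p) F] : AddChar F ℂ :=
  (AddChar.zmodChar p (zetaP_pow p hp.out.ne_zero)).compAddMonoidHom
    (Algebra.trace (ZMod p) F).toAddMonoidHom

/-- Gauss sum `G_m = G(T^m)` with respect to the canonical additive character. -/
noncomputable def GG (p : ℕ) [Fact p.Prime] {F : Type*} [Field F] [Fintype F]
    [Algebra (ZMod p) F] (T : MulChar F ℂ) (m : ℤ) : ℂ :=
  gaussSum (T ^ m) (theta p F)

/-- Greene's binomial coefficient `binom(A,B) = (B(-1)/q) J(A, B⁻¹)`. -/
noncomputable def greeneBinom (F : Type*) [Field F] [Fintype F] (A B : MulChar F ℂ) : ℂ :=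
  B (-1) / (Fintype.card F : ℂ) * ∑ x : F, A x * B⁻¹ (1 - x)

/-- Greene's hypergeometric series `₂F₁(A,B;C|x)`, with the sum over all characters
written as a sum over the powers of a generator `T` of the character group. -/
noncomputable def hyp2F1 {F : Type*} [Field F] [Fintype F] (T A B C : MulChar F ℂ) (x : F) : ℂ :=
  (Fintype.card F : ℂ) / ((Fintype.card F : ℂ) - 1) *
    ∑ n ∈ Finset.range (Fintype.card F - 1),
      greeneBinom F (A * T ^ n) (T ^ n) * greeneBinom F (B * T ^ n) (C * T ^ n) * (T ^ n) x


open Classical in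
/-- complex valued quadratic character -/
noncomputable def qc (F : Type*) [Field F] [Fintype F] : MulChar F ℂ :=
  (quadraticChar F).ringHomComp (Int.castRingHom ℂ)

section aux
variable {F : Type*} [Field F] [Fintype F]

open Classical in
lemma qc_count (h2 : ringChar F ≠ 2) (a : F) :
    ∑ x : F, (if x ^ 2 = a then (1 : ℂ) else 0) = qc F a + 1 := by
  have := quadraticChar_card_sqrts h2 a
  have h := congrArg (fun z : ℤ => (z : ℂ)) this
  simp only [Int.cast_natCast, Int.cast_add, Int.cast_one] at h
  rw [show qc F a = ((quadraticChar F a : ℤ) : ℂ) from rfl, ← h, Finset.sum_boole]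
  congr 2
  ext x; simp

open Classical in
lemma qc_sq {a : F} (ha : a ≠ 0) : qc F (a ^ 2) = 1 := by
  have := quadraticChar_sq_one' ha
  rw [show qc F (a ^ 2) = ((quadraticChar F (a ^ 2) : ℤ) : ℂ) from rfl, this]
  simp

open Classical in
lemma qc_sum (h2 : ringChar F ≠ 2) : ∑ x : F, qc F x = 0 := by
  have := quadraticChar_sum_zero h2 (F := F)
  have h := congrArg (fun z : ℤ => (z : ℂ)) this
  simp only [Int.cast_sum, Int.cast_zero] at h
  rw [← h]
  rfl

lemma two_ne (h2 : ringChar F ≠ 2) : (2 : F) ≠ 0 := Ring.two_ne_zero h2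

open Classical in
lemma quad_count (h2 : ringChar F ≠ 2) (b c : F) :
    ∑ x : F, (if x ^ 2 - b * x + c = 0 then (1 : ℂ) else 0) = qc F (b ^ 2 - 4 * c) + 1 := by
  have t := two_ne h2
  rw [← qc_count h2]
  apply Fintype.sum_equiv ((Equiv.mulLeft₀ (2 : F) t).trans (Equiv.subRight b))
  intro x
  change _ = if (2 * x - b) ^ 2 = b ^ 2 - 4 * c then (1 : ℂ) else 0
  congr 1
  apply propext
  constructor
  · intro h; linear_combination 4 * h
  · intro h
    have : (2 : F) ^ 2 * (x ^ 2 - b * x + c) = 0 := by linear_combination h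
    simpa [t] using this

open Classical in
lemma sum_inv (h2 : ringChar F ≠ 2) (G : F → ℂ) :
    ∑ s : F, (if s ≠ 0 then G (s + s⁻¹) else 0) = ∑ z : F, (qc F (z ^ 2 - 4) + 1) * G z := by
  have h : ∀ z : F, (qc F (z ^ 2 - 4) + 1) * G z
      = ∑ s : F, if s ≠ 0 then (if z = s + s⁻¹ then G z else 0) else 0 := by
    intro z
    have := quad_count h2 z 1
    rw [mul_one] at this
    rw [← this, Finset.sum_mul]
    apply Finset.sum_congr rfl
    intro s _
    by_cases hs : s = 0
    · simp [hs]
    · have : s ^ 2 - z * s + 1 = 0 ↔ z = s + s⁻¹ := by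
        constructor
        · intro h; field_simp; linear_combination -h
        · intro h; rw [h]; field_simp; ring
      simp only [this, hs, ne_eq, not_false_eq_true, if_true, ite_mul, one_mul, zero_mul]
  simp_rw [h]
  rw [Finset.sum_comm]
  apply Finset.sum_congr rfl
  intro s _
  by_cases hs : s = 0 <;> simp [hs]

lemma perm_lemma (h2 : ringChar F ≠ 2) (h3 : (3 : F) ≠ 0) (h33 : ∃ r : F, r ^ 2 = -3) (g : F → ℂ) :
    ∑ w : F, (1 - qc F (w ^ 2 - 4)) * g (w ^ 3 - 3 * w)
      = ∑ z : F, (1 - qc F (z ^ 2 - 4)) * g z := by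
  classical
  obtain ⟨r, hr⟩ := h33
  have t := two_ne h2
  have r0 : r ≠ 0 := by rintro rfl; apply h3; linear_combination hr
  have hm3 : qc F (-3) = 1 := by rw [← hr]; exact qc_sq r0
  let D : Finset F := Finset.univ.filter (fun w => 1 - qc F (w ^ 2 - 4) ≠ 0)
  have red : ∀ f : F → ℂ, ∑ w : F, (1 - qc F (w ^ 2 - 4)) * f w
      = ∑ w ∈ D, (1 - qc F (w ^ 2 - 4)) * f w := by
    intro f
    symm
    apply Finset.sum_subset (Finset.subset_univ _)
    intro x _ hx
    have : 1 - qc F (x ^ 2 - 4) = 0 := by simpa [D] using hx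
    rw [this, zero_mul]
  have n1 : ∀ w ∈ D, w ^ 2 - 1 ≠ 0 := by
    intro w hw h
    have : 1 - qc F (w ^ 2 - 4) ≠ 0 := by simpa [D] using hw
    apply this
    rw [show w ^ 2 - 4 = -3 by linear_combination h, hm3, sub_self]
  have wt : ∀ w ∈ D, qc F ((w ^ 3 - 3 * w) ^ 2 - 4) = qc F (w ^ 2 - 4) := by
    intro w hw
    rw [show (w ^ 3 - 3 * w) ^ 2 - 4 = (w ^ 2 - 4) * (w ^ 2 - 1) ^ 2 by ring, map_mul,
      qc_sq (n1 w hw), mul_one]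
  have maps : ∀ w ∈ D, w ^ 3 - 3 * w ∈ D := by
    intro w hw
    have h : 1 - qc F (w ^ 2 - 4) ≠ 0 := by simpa [D] using hw
    have := wt w hw
    simp only [D, Finset.mem_filter, Finset.mem_univ, true_and, this]
    exact h
  have inj : Set.InjOn (fun w : F => w ^ 3 - 3 * w) D := by
    intro w hw v hv h
    by_contra hne
    have h1 : w ^ 2 + w * v + v ^ 2 - 3 = 0 := by
      have : (w - v) * (w ^ 2 + w * v + v ^ 2 - 3) = 0 := by
        simp only at h; linear_combination h
      rcases mul_eq_zero.1 this with h' | h'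
      · exact absurd (sub_eq_zero.1 h') hne
      · exact h'
    have h4 : r ^ 2 * (w ^ 2 - 4) = (2 * v + w) ^ 2 := by
      rw [hr]; linear_combination -4 * h1
    have h : 1 - qc F (w ^ 2 - 4) ≠ 0 := by simpa [D] using hw
    by_cases h0 : 2 * v + w = 0
    · apply n1 v hv
      have : w = - 2 * v := by linear_combination h0
      subst this
      have : (3 : F) * (v ^ 2 - 1) = 0 := by linear_combination h1
      simpa [h3] using this
    · apply h
      rw [show w ^ 2 - 4 = ((2 * v + w) / r) ^ 2 by field_simp; linear_combination h4,
        qc_sq (div_ne_zero h0 r0), sub_self]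
  rw [red, red]
  apply Finset.sum_bij (fun w _ => w ^ 3 - 3 * w) maps
  · intro a ha b hb h; exact inj ha hb h
  · intro z hz
    have := Finset.surj_on_of_inj_on_of_card_le (s := D) (t := D) (fun w _ => w ^ 3 - 3 * w) maps
      (fun a b ha hb h => inj ha hb h) le_rfl z hz
    obtain ⟨a, ha, h⟩ := this
    exact ⟨a, ha, h.symm⟩
  · intro w hw; rw [wt w hw]

/-- key identity, given a cubic character -/
lemma cubic_key (h2 : ringChar F ≠ 2) (h3 : (3 : F) ≠ 0) (h33 : ∃ r : F, r ^ 2 = -3)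
    (ρ : MulChar F ℂ) (hρ : ρ ^ 3 = 1)
    (hcube : ∀ G : F → ℂ, G 0 = 0 →
      ∑ s : F, G (s ^ 3) = ∑ t : F, (1 + ρ t + (ρ t) ^ 2) * G t) (d : F) :
    ∑ t : F, ρ t * qc F (t + t⁻¹ + d) = ∑ w : F, qc F (w ^ 3 - 3 * w + d) := by
  classical
  set S := ∑ t : F, ρ t * qc F (t + t⁻¹ + d) with hS
  have hS2 : ∑ t : F, (ρ t) ^ 2 * qc F (t + t⁻¹ + d) = S := by
    rw [hS]
    apply Fintype.sum_equiv (Equiv.inv F)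
    intro t
    simp only [Equiv.inv_apply, inv_inv]
    rw [add_comm t]
    congr 1
    rw [← MulChar.inv_apply', show ρ⁻¹ = ρ ^ 2 from inv_eq_of_mul_eq_one_left (by rw [← pow_succ, hρ]),
      MulChar.pow_apply' _ two_ne_zero]
  have hg : ∑ z : F, qc F (z + d) = 0 := by
    rw [← qc_sum h2]
    exact Fintype.sum_equiv (Equiv.addRight d) _ _ (fun _ => rfl)
  have e1 := hcube (fun t => if t ≠ 0 then qc F (t + t⁻¹ + d) else 0) (by simp)
  have e2 : ∑ s : F, (if s ^ 3 ≠ 0 then qc F (s ^ 3 + (s ^ 3)⁻¹ + d) else 0)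
      = ∑ w : F, (qc F (w ^ 2 - 4) + 1) * qc F (w ^ 3 - 3 * w + d) := by
    rw [← sum_inv h2 (fun w => qc F (w ^ 3 - 3 * w + d))]
    apply Finset.sum_congr rfl
    intro s _
    by_cases hs : s = 0
    · simp [hs]
    · simp only [hs, ne_eq, pow_eq_zero_iff, not_false_eq_true, if_true, OfNat.ofNat_ne_zero]
      congr 2
      field_simp
      ring
  have e3 := sum_inv h2 (fun z => qc F (z + d))
  have e4 : ∑ t : F, (1 + ρ t + (ρ t) ^ 2) * (if t ≠ 0 then qc F (t + t⁻¹ + d) else 0)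
      = (∑ t : F, if t ≠ 0 then qc F (t + t⁻¹ + d) else 0) + S + S := by
    nth_rewrite 2 [← hS2]
    rw [hS, ← Finset.sum_add_distrib, ← Finset.sum_add_distrib]
    apply Finset.sum_congr rfl
    intro t _
    by_cases ht : t = 0
    · simp [ht, MulChar.map_zero]
    · simp only [ht, ne_eq, not_false_eq_true, if_true]; ring
  have e5 := perm_lemma h2 h3 h33 (fun z => qc F (z + d))
  simp only [sub_mul, add_mul, one_mul, Finset.sum_add_distrib, Finset.sum_sub_distrib] at e5 e3 e2
  rw [e2, e4, e3, hg] at e1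
  rw [hg] at e5
  linear_combination (-1 / 2 : ℂ) * e1 - (1 / 2 : ℂ) * e5

end aux

section aux2
variable {F : Type*} [Field F] [Fintype F]

lemma cube_data (hq : Fintype.card F % 6 = 1) :
    ∃ w : F, w ^ 2 + w + 1 = 0 := by
  classical
  obtain ⟨g, hg⟩ := IsCyclic.exists_generator (α := Fˣ)
  have ho : orderOf g = Fintype.card F - 1 := by
    rw [orderOf_eq_card_of_forall_mem_zpowers hg, Nat.card_eq_fintype_card, Fintype.card_units]
  have hc : 1 < Fintype.card F := Fintype.one_lt_card
  obtain ⟨m, hm⟩ : ∃ m, Fintype.card F - 1 = 3 * m := ⟨(Fintype.card F - 1) / 3, by omega⟩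
  have h1 : ((g ^ m : Fˣ) : F) ≠ 1 := by
    intro h
    have : g ^ m = 1 := by ext; simpa using h
    have := orderOf_dvd_of_pow_eq_one this
    have := Nat.le_of_dvd (by omega) this
    omega
  have h3 : ((g ^ m : Fˣ) : F) ^ 3 = 1 := by
    rw [← Units.val_pow_eq_pow_val, ← pow_mul, mul_comm m 3, ← hm, ← ho, pow_orderOf_eq_one]; rfl
  refine ⟨((g ^ m : Fˣ) : F), ?_⟩
  have : (((g ^ m : Fˣ) : F) - 1) * (((g ^ m : Fˣ) : F) ^ 2 + ((g ^ m : Fˣ) : F) + 1) = 0 := by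
    linear_combination h3
  rcases mul_eq_zero.1 this with h | h
  · exact absurd (sub_eq_zero.1 h) h1
  · exact h

lemma rho_cube (ρ : MulChar F ℂ) (hρ : ρ ^ 3 = 1) (hρ1 : ρ ≠ 1) (t : F) (ht : t ≠ 0)
    (h : ρ t = 1) : ∃ s : F, s ^ 3 = t := by
  classical
  obtain ⟨g, hg⟩ := IsCyclic.exists_generator (α := Fˣ)
  have hg1 : ρ g ≠ 1 := by
    intro h1
    apply hρ1
    rw [MulChar.eq_one_iff]
    intro a
    obtain ⟨n, rfl⟩ := (mem_powers_iff_mem_zpowers.2 (hg a))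
    simp [h1]
  have hg3 : ρ g ^ 3 = 1 := by
    have := congrArg (fun χ : MulChar F ℂ => χ g) hρ
    simpa [MulChar.pow_apply_coe] using this
  have ho : orderOf (ρ g) = 3 := orderOf_eq_prime hg3 hg1
  obtain ⟨n, hn⟩ := (mem_powers_iff_mem_zpowers.2 (hg (Units.mk0 t ht)))
  have hn' : (g : F) ^ n = t := by
    have := congrArg (fun u : Fˣ => (u : F)) hn
    simpa using this
  have : ρ g ^ n = 1 := by rw [← map_pow, hn', h]
  obtain ⟨j, rfl⟩ := ho ▸ orderOf_dvd_of_pow_eq_one this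
  exact ⟨(g : F) ^ j, by rw [← pow_mul, mul_comm j 3, hn']⟩

lemma cube_sum (hq : Fintype.card F % 6 = 1) (h3 : (3 : F) ≠ 0)
    (ρ : MulChar F ℂ) (hρ : ρ ^ 3 = 1) (hρ1 : ρ ≠ 1) (G : F → ℂ) (hG : G 0 = 0) :
    ∑ s : F, G (s ^ 3) = ∑ t : F, (1 + ρ t + (ρ t) ^ 2) * G t := by
  classical
  obtain ⟨w, hw⟩ := cube_data hq
  have key : ∀ t : F, (1 + ρ t + (ρ t) ^ 2) * G t = ∑ s : F, if t = s ^ 3 then G t else 0 := by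
    intro t
    by_cases ht : t = 0
    · subst ht; simp [hG]
    have hc3 : ρ t ^ 3 = 1 := by
      have := congrArg (fun χ : MulChar F ℂ => χ t) hρ
      rw [MulChar.pow_apply' _ three_ne_zero] at this
      simpa [MulChar.one_apply (Ne.isUnit ht)] using this
    by_cases h : ρ t = 1
    · obtain ⟨s0, hs0⟩ := rho_cube ρ hρ hρ1 t ht h
      have s00 : s0 ≠ 0 := by rintro rfl; apply ht; rw [← hs0]; ring
      have w1 : w ≠ 1 := by
        rintro rfl; apply h3; linear_combination hw
      have w2 : w ^ 2 ≠ 1 := by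
        intro h'
        have : w = -2 := by linear_combination hw - h'
        apply h3; rw [this] at h'; linear_combination h'
      have w0 : w ≠ 0 := by rintro rfl; simp at hw
      have w12 : w ^ 2 ≠ w := by
        intro h'; apply w1; field_simp at h'; exact h'
      have hf : (Finset.univ.filter (fun s : F => t = s ^ 3)) = {s0, w * s0, w ^ 2 * s0} := by
        ext s
        simp only [Finset.mem_filter, Finset.mem_univ, true_and, Finset.mem_insert,
          Finset.mem_singleton]
        constructor
        · intro hs
          have : (s - s0) * ((s - w * s0) * (s - w ^ 2 * s0)) = 0 := by
            have hw3 : w ^ 3 = 1 := by linear_combination (w - 1) * hw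
            linear_combination -hs0 - hs - (s - s0) * s * s0 * hw + s0 ^ 2 * (s - s0) * hw3
          rcases mul_eq_zero.1 this with h | h
          · left; exact sub_eq_zero.1 h
          rcases mul_eq_zero.1 h with h | h
          · right; left; exact sub_eq_zero.1 h
          · right; right; exact sub_eq_zero.1 h
        · have hw3 : w ^ 3 = 1 := by linear_combination (w - 1) * hw
          rintro (rfl | rfl | rfl)
          · exact hs0.symm
          · rw [mul_pow, hw3, hs0, one_mul]
          · rw [mul_pow, ← pow_mul, mul_comm 2 3, pow_mul, hw3, hs0, one_pow, one_mul]
      rw [← Finset.sum_filter, Finset.sum_const, hf, Finset.card_eq_three.2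
        ⟨s0, w * s0, w ^ 2 * s0, ?_, ?_, ?_, rfl⟩, h]
      · simp; left; norm_num
      · intro h'; apply w1; field_simp at h'; exact h'.symm
      · intro h'; apply w2; field_simp at h'; exact h'.symm
      · intro h'; apply w12; exact (mul_right_cancel₀ s00 h').symm
    · have : 1 + ρ t + ρ t ^ 2 = 0 := by
        have : (ρ t - 1) * (1 + ρ t + ρ t ^ 2) = 0 := by linear_combination hc3
        rcases mul_eq_zero.1 this with h' | h'
        · exact absurd (sub_eq_zero.1 h') h
        · exact h'
      rw [this, zero_mul]
      symm
      apply Finset.sum_eq_zero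
      intro s _
      rw [if_neg]
      intro hs
      apply h
      have s0 : s ≠ 0 := by rintro rfl; apply ht; rw [hs]; ring
      have := congrArg (fun χ : MulChar F ℂ => χ s) hρ
      rw [MulChar.pow_apply' _ three_ne_zero, MulChar.one_apply (Ne.isUnit s0), ← map_pow, ← hs] at this
      exact this
  simp_rw [key]
  rw [Finset.sum_comm]
  simp

lemma order_T (T : MulChar F ℂ) (hT : ∀ χ : MulChar F ℂ, ∃ n : ℕ, χ = T ^ n) :
    orderOf T = Fintype.card F - 1 := by
  classical
  have h := MulChar.card_eq_card_units_of_hasEnoughRootsOfUnity F ℂ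
  rw [Nat.card_eq_fintype_card (α := Fˣ), Fintype.card_units] at h
  rw [← h]
  apply orderOf_eq_card_of_forall_mem_zpowers
  intro χ
  obtain ⟨n, rfl⟩ := hT χ
  exact ⟨n, by simp⟩

open Classical in
lemma orth (T : MulChar F ℂ) (hT : ∀ χ : MulChar F ℂ, ∃ n : ℕ, χ = T ^ n) (z : F) :
    ∑ n ∈ Finset.range (Fintype.card F - 1), (T ^ n) z
      = if z = 1 then (Fintype.card F : ℂ) - 1 else 0 := by
  have hc : 1 < Fintype.card F := Fintype.one_lt_card
  by_cases h1 : z = 1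
  · subst h1
    simp [Nat.cast_sub hc.le]
  rw [if_neg h1]
  by_cases h0 : z = 0
  · subst h0
    simp [MulChar.map_zero]
  have hu : IsUnit z := Ne.isUnit h0
  obtain ⟨u, rfl⟩ := hu
  have hTz : T u ≠ 1 := by
    intro h
    obtain ⟨χ, hχ⟩ := MulChar.exists_apply_ne_one_of_hasEnoughRootsOfUnity F ℂ h1
    obtain ⟨n, rfl⟩ := hT χ
    apply hχ
    rw [MulChar.pow_apply_coe, h, one_pow]
  simp_rw [MulChar.pow_apply_coe]
  rw [geom_sum_eq hTz, ← MulChar.pow_apply_coe, ← order_T T hT, pow_orderOf_eq_one]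
  simp

lemma qc_ne_one (h2 : ringChar F ≠ 2) : qc F ≠ 1 := by
  classical
  intro h
  have := qc_sum (F := F) h2
  rw [h, MulChar.sum_one_eq_card_units] at this
  have h' := Fintype.card_pos (α := Fˣ)
  simp at this

lemma qc_eq (h2 : ringChar F ≠ 2) (hq : Fintype.card F % 6 = 1)
    (T : MulChar F ℂ) (hT : ∀ χ : MulChar F ℂ, ∃ n : ℕ, χ = T ^ n) :
    T ^ ((Fintype.card F - 1) / 2) = qc F := by
  obtain ⟨n, hn⟩ := hT (qc F)
  have hsq : qc F ^ 2 = 1 := by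
    rw [MulChar.eq_one_iff]
    intro a
    rw [MulChar.pow_apply_coe, ← map_pow, qc_sq a.ne_zero]
  have hne := qc_ne_one (F := F) h2
  have ho := order_T T hT
  have hc : 1 < Fintype.card F := Fintype.one_lt_card
  obtain ⟨m, hm⟩ : ∃ m, Fintype.card F - 1 = 2 * m := ⟨(Fintype.card F - 1) / 2, by omega⟩
  rw [hm] at ho ⊢
  rw [Nat.mul_div_cancel_left _ two_pos]
  rw [hn, ← pow_mul] at hsq
  have hd := orderOf_dvd_of_pow_eq_one hsq
  rw [ho, mul_comm n 2] at hd
  obtain ⟨j, rfl⟩ := Nat.dvd_of_mul_dvd_mul_left two_pos hd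
  rw [hn]
  have hT2 : T ^ (2 * m) = 1 := by rw [← ho, pow_orderOf_eq_one]
  rcases Nat.even_or_odd' j with ⟨i, rfl | rfl⟩
  · exfalso
    apply hne
    rw [hn, show m * (2 * i) = (2 * m) * i by ring, pow_mul, hT2, one_pow]
  · rw [show m * (2 * i + 1) = (2 * m) * i + m by ring, pow_add, pow_mul, hT2, one_pow, one_mul]

open Classical in
lemma hyp_eval (T : MulChar F ℂ) (hT : ∀ χ : MulChar F ℂ, ∃ n : ℕ, χ = T ^ n)
    (A B : MulChar F ℂ) (l : F) :
    (Fintype.card F : ℂ) * hyp2F1 T A B 1 l = ∑ x : F, ∑ y : F,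
      if x * (1 - x)⁻¹ * (y * (1 - y)⁻¹) * l = 1 then A x * B y else 0 := by
  have hc : 1 < Fintype.card F := Fintype.one_lt_card
  have q0 : (Fintype.card F : ℂ) ≠ 0 := by exact_mod_cast (by omega : Fintype.card F ≠ 0)
  have q1 : (Fintype.card F : ℂ) - 1 ≠ 0 := by
    rw [sub_ne_zero]; exact_mod_cast hc.ne'
  have e : ∀ n : ℕ, greeneBinom F (A * T ^ n) (T ^ n) * greeneBinom F (B * T ^ n) (1 * T ^ n)
      * (T ^ n) l = (1 / (Fintype.card F : ℂ) ^ 2) * ∑ x : F, ∑ y : F,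
        A x * B y * (T ^ n) (x * (1 - x)⁻¹ * (y * (1 - y)⁻¹) * l) := by
    intro n
    have hm : (T ^ n) (-1) * (T ^ n) (-1) = 1 := by rw [← map_mul]; simp
    simp only [greeneBinom, one_mul]
    rw [show ∀ a b c d f : ℂ, a / b * c * (a / b * d) * f = (a * a) * (1 / b ^ 2) * (c * d * f) by
      intros; ring, hm, one_mul]
    congr 1
    rw [Finset.sum_mul_sum, Finset.sum_mul]
    apply Finset.sum_congr rfl
    intro x _
    rw [Finset.sum_mul]
    apply Finset.sum_congr rfl
    intro y _
    simp only [MulChar.mul_apply, MulChar.inv_apply', map_mul]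
    ring
  simp only [hyp2F1, e]
  rw [← Finset.mul_sum, Finset.sum_comm]
  have key : ∀ S : ℂ, (Fintype.card F : ℂ) * ((Fintype.card F : ℂ) / ((Fintype.card F : ℂ) - 1) *
      (1 / (Fintype.card F : ℂ) ^ 2 * S)) = (1 / ((Fintype.card F : ℂ) - 1)) * S := by
    intro S; field_simp
  rw [key, Finset.mul_sum]
  apply Finset.sum_congr rfl
  intro x _
  rw [Finset.sum_comm, Finset.mul_sum]
  apply Finset.sum_congr rfl
  intro y _
  rw [← Finset.mul_sum, orth T hT]
  split_ifs
  · field_simp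
  · simp

lemma hyp_eval2 (h2 : ringChar F ≠ 2) (T : MulChar F ℂ)
    (hT : ∀ χ : MulChar F ℂ, ∃ n : ℕ, χ = T ^ n)
    (A : MulChar F ℂ) (hA : A ≠ 1) (l : F) (hl0 : l ≠ 0) (hl1 : l ≠ 1) :
    (Fintype.card F : ℂ) * hyp2F1 T A A⁻¹ 1 l = ∑ t : F, (A * qc F) t * qc F (t + t⁻¹ + (4 * l - 2)) := by
  classical
  rw [hyp_eval T hT]
  have step1 : ∀ y : F, ∑ x : F, (if x * (1 - x)⁻¹ * (y * (1 - y)⁻¹) * l = 1 then A x * A⁻¹ y else 0)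
      = ∑ t : F, if (y⁻¹) ^ 2 - (1 + t) * y⁻¹ + (1 - l) * t = 0 then A t else 0 := by
    intro y
    by_cases hy : y = 0
    · subst hy
      simp only [inv_zero, zero_mul, mul_zero, zero_ne_one, if_false, Finset.sum_const_zero]
      symm
      apply Finset.sum_eq_zero
      intro t _
      split_ifs with h
      · have : t = 0 := by
          have h1 : (1 - l) * t = 0 := by linear_combination h
          rcases mul_eq_zero.1 h1 with h | h
          · exact absurd (sub_eq_zero.1 h).symm hl1
          · exact h
        rw [this, MulChar.map_zero]
      · rfl
    symm
    apply Fintype.sum_equiv (Equiv.mulRight₀ y hy)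
    intro t
    change _ = if (t * y) * (1 - t * y)⁻¹ * (y * (1 - y)⁻¹) * l = 1 then A (t * y) * A⁻¹ y else 0
    have hAt : A (t * y) * A⁻¹ y = A t := by
      rw [MulChar.inv_apply', ← map_mul, mul_assoc, mul_inv_cancel₀ hy, mul_one]
    rw [hAt]
    by_cases ht : t = 0
    · subst ht; simp [MulChar.map_zero]
    congr 1
    apply propext
    constructor
    · intro h
      have h' : (1 - t * y) * (1 - y) = t * y * y * l := by
        field_simp at h
        linear_combination h
      have hne : (1 - t * y) * (1 - y) ≠ 0 := by
        rw [h']; simp [ht, hy, hl0]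
      have ha := left_ne_zero_of_mul hne
      have hb := right_ne_zero_of_mul hne
      field_simp
      linear_combination -h'
    · intro h
      have hne : (1 - t * y) * (1 - y) ≠ 0 := by
        intro h'; simp only [mul_eq_zero] at h'; rcases h' with h' | h' <;> simp [h'] at h
      have ha := left_ne_zero_of_mul hne
      have hb := right_ne_zero_of_mul hne
      field_simp at h ⊢
      linear_combination -h
  rw [Finset.sum_comm]
  simp_rw [step1]
  rw [Finset.sum_comm]
  have step2 : ∀ t : F, ∑ y : F, (if (y⁻¹) ^ 2 - (1 + t) * y⁻¹ + (1 - l) * t = 0 then A t else 0)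
      = A t + (A * qc F) t * qc F (t + t⁻¹ + (4 * l - 2)) := by
    intro t
    have h := quad_count h2 (1 + t) ((1 - l) * t)
    have : ∑ y : F, (if (y⁻¹) ^ 2 - (1 + t) * y⁻¹ + (1 - l) * t = 0 then A t else 0)
        = A t * ∑ x : F, (if x ^ 2 - (1 + t) * x + (1 - l) * t = 0 then (1 : ℂ) else 0) := by
      rw [Finset.mul_sum]
      apply Fintype.sum_equiv (Equiv.inv F)
      intro y
      simp
    rw [this, h]
    by_cases ht : t = 0
    · simp [ht, MulChar.map_zero]
    rw [MulChar.mul_apply, mul_assoc, ← map_mul (qc F)]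
    have : (1 + t) ^ 2 - 4 * ((1 - l) * t) = t * (t + t⁻¹ + (4 * l - 2)) := by
      field_simp; ring
    rw [this]; ring
  simp_rw [step2]
  rw [Finset.sum_add_distrib, MulChar.sum_eq_zero_of_ne_one hA, zero_add]

end aux2

open Classical in
lemma card_curve {F : Type*} [Field F] [Fintype F] (h2 : ringChar F ≠ 2) (P : F → F) :
    (Nat.card {s : F × F // s.2 ^ 2 = P s.1} : ℂ) = Fintype.card F + ∑ x : F, qc F (P x) := by
  rw [Nat.card_eq_fintype_card, Fintype.card_subtype, ← Finset.sum_boole, Fintype.sum_prod_type]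
  simp only [qc_count h2]
  rw [Finset.sum_add_distrib]
  simp [add_comm]

theorem stmt8 {p : ℕ} [hp : Fact p.Prime] (hp2 : p ≠ 2) {F : Type*} [Field F] [Fintype F]
    [Algebra (ZMod p) F] (hq : Fintype.card F % 6 = 1) (a b : F) (ha : a ≠ 0)
    (hsq : IsSquare (-a / 3)) (k : F) (hk : 3 * k ^ 2 + a = 0)
    (hns : 4 * a ^ 3 + 27 * b ^ 2 ≠ 0) (T : MulChar F ℂ) (hT : ∀ χ : MulChar F ℂ, ∃ n : ℕ, χ = T ^ n) :
    (Fintype.card F : ℂ) + 1 - ((Nat.card {s : F × F // s.2 ^ 2 = s.1 ^ 3 + a * s.1 + b} : ℂ) + 1) =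
      -(Fintype.card F : ℂ) * (T ^ ((Fintype.card F - 1) / 2)) (-k) *
        hyp2F1 T (T ^ ((Fintype.card F - 1) / 6)) (T ^ ((5 * (Fintype.card F - 1)) / 6)) 1
          (-(k ^ 3 + a * k + b) / (4 * k ^ 3)) := by
  classical
  have hc : 1 < Fintype.card F := Fintype.one_lt_card
  have hchar : CharP F p := charP_of_injective_algebraMap (algebraMap (ZMod p) F).injective p
  have h2 : ringChar F ≠ 2 := by rw [ringChar.eq F p]; exact hp2
  have t2 : (2 : F) ≠ 0 := two_ne h2
  obtain ⟨w, hw⟩ := cube_data hq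
  have h3 : (3 : F) ≠ 0 := by
    intro h
    have hd : p ∣ Fintype.card F := by
      rw [← CharP.cast_eq_zero_iff F p]; exact FiniteField.cast_card_eq_zero F
    have hp3 : p ∣ 3 := by
      rw [← CharP.cast_eq_zero_iff F p]; exact_mod_cast h
    have : p = 3 := (Nat.prime_dvd_prime_iff_eq hp.out Nat.prime_three).1 hp3
    subst this
    omega
  have h33 : ∃ r : F, r ^ 2 = -3 := ⟨2 * w + 1, by linear_combination 4 * hw⟩
  have k0 : k ≠ 0 := by rintro rfl; apply ha; linear_combination hk
  have hae : a = -3 * k ^ 2 := by linear_combination hk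
  subst hae
  have hb : (b - 2 * k ^ 3) * (b + 2 * k ^ 3) ≠ 0 := by
    intro h; apply hns; linear_combination 27 * h
  have hb1 := left_ne_zero_of_mul hb
  have hb2 := right_ne_zero_of_mul hb
  have t4 : (4 : F) ≠ 0 := by
    rw [show (4 : F) = 2 * 2 by norm_num]; exact mul_ne_zero t2 t2
  have h4k : 4 * k ^ 3 ≠ 0 := mul_ne_zero t4 (pow_ne_zero _ k0)
  set l := -(k ^ 3 + -3 * k ^ 2 * k + b) / (4 * k ^ 3) with hl
  have hl' : 4 * k ^ 3 * l = 2 * k ^ 3 - b := by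
    rw [hl]; field_simp; ring
  clear_value l
  have hl0 : l ≠ 0 := by
    intro h; rw [h] at hl'; apply hb1; linear_combination hl'
  have hl1 : l ≠ 1 := by
    intro h; rw [h] at hl'; apply hb2; linear_combination hl'
  have ho := order_T T hT
  obtain ⟨m, hm⟩ : ∃ m, Fintype.card F - 1 = 6 * m := ⟨(Fintype.card F - 1) / 6, by omega⟩
  have m0 : 0 < m := by omega
  have hT6 : T ^ (6 * m) = 1 := by rw [← hm, ← ho, pow_orderOf_eq_one]
  have hqc := qc_eq h2 hq T hT
  rw [hqc, hm, show 5 * (6 * m) / 6 = 5 * m by omega, show 6 * m / 6 = m by omega]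
  rw [hm, show 6 * m / 2 = 3 * m by omega] at hqc
  have hinv : T ^ (5 * m) = (T ^ m)⁻¹ := by
    rw [eq_inv_iff_mul_eq_one, ← pow_add, show 5 * m + m = 6 * m by ring, hT6]
  have nd : ∀ j, 0 < j → j < 6 → T ^ (j * m) ≠ 1 := by
    intro j hj hj6 h
    have := Nat.le_of_dvd (by positivity) (orderOf_dvd_of_pow_eq_one h)
    rw [ho, hm] at this
    have := Nat.le_of_mul_le_mul_right this m0
    omega
  have hA : T ^ m ≠ 1 := by simpa using nd 1 (by norm_num) (by norm_num)
  have hrho : T ^ m * qc F = T ^ (4 * m) := by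
    rw [← hqc, ← pow_add]; congr 1; ring
  have hev := hyp_eval2 h2 T hT (T ^ m) hA l hl0 hl1
  have hρ3 : (T ^ (4 * m)) ^ 3 = 1 := by
    rw [← pow_mul, show 4 * m * 3 = 6 * m * 2 by ring, pow_mul, hT6, one_pow]
  rw [hrho, cubic_key h2 h3 h33 (T ^ (4 * m)) hρ3
    (fun G hG => cube_sum hq h3 _ hρ3 (nd 4 (by norm_num) (by norm_num)) G hG)] at hev
  rw [hinv, card_curve h2 (fun x => x ^ 3 + -3 * k ^ 2 * x + b)]
  have hsum : ∑ x : F, qc F (x ^ 3 + -3 * k ^ 2 * x + b)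
      = qc F (-k) * ∑ w : F, qc F (w ^ 3 - 3 * w + (4 * l - 2)) := by
    rw [Finset.mul_sum]
    symm
    apply Fintype.sum_equiv (Equiv.mulRight₀ (-k) (neg_ne_zero.2 k0))
    intro w
    change _ = qc F ((w * (-k)) ^ 3 + -3 * k ^ 2 * (w * (-k)) + b)
    rw [← map_mul, show (w * (-k)) ^ 3 + -3 * k ^ 2 * (w * (-k)) + b
      = (-k * (w ^ 3 - 3 * w + (4 * l - 2))) * k ^ 2 by linear_combination hl',
      map_mul (qc F) _ (k ^ 2), qc_sq k0, mul_one]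
  rw [hsum, ← hev]
  ring
end

section
/- Let q ≡ 1 (mod 4), T a generator of the character group of F_q^×, and l an integer. Then G_{2l+(q-1)/2} = G_{l+(q-1)/4}·G_{l+3(q-1)/4}·T^{l−(q-1)/4}(4) / G_{(q-1)/2} (Davenport–Hasse relation for m = 2 with ψ = T^{l+(q-1)/4}). -/
open Finset Complex

lemma theta_primitive (p : ℕ) [hp : Fact p.Prime] (F : Type*) [Field F] [Fintype F]
    [Algebra (ZMod p) F] : (theta p F).IsPrimitive := by
  apply AddChar.IsPrimitive.of_ne_one
  intro h
  obtain ⟨a, ha⟩ := Algebra.trace_surjective (ZMod p) F 1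
  have h1 : theta p F a = 1 := by rw [h]; rfl
  have h2 : theta p F a = zetaP p ^ (1 : ZMod p).val := by
    rw [← ha]; rfl
  have hprim : IsPrimitiveRoot (zetaP p) p := Complex.isPrimitiveRoot_exp p hp.out.ne_zero
  haveI : Fact (1 < p) := ⟨hp.out.one_lt⟩
  rw [h1, ZMod.val_one, pow_one] at h2
  exact hprim.ne_one hp.out.one_lt h2.symm

lemma char_orderOf {F : Type*} [Field F] [Fintype F] (T : MulChar F ℂ)
    (hT : ∀ χ : MulChar F ℂ, ∃ n : ℕ, χ = T ^ n) : orderOf T = Fintype.card F - 1 := by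
  classical
  have h : ∀ x : MulChar F ℂ, x ∈ Subgroup.zpowers T := by
    intro x
    obtain ⟨n, rfl⟩ := hT x
    exact ⟨n, by simp⟩
  rw [orderOf_eq_card_of_forall_mem_zpowers h,
    MulChar.card_eq_card_units_of_hasEnoughRootsOfUnity F ℂ, Nat.card_eq_fintype_card,
    Fintype.card_units]

lemma char_sq_one {F : Type*} [Field F] [Fintype F] (T : MulChar F ℂ)
    (hT : ∀ χ : MulChar F ℂ, ∃ n : ℕ, χ = T ^ n) {h : ℕ} (hq : Fintype.card F - 1 = 2 * h)
    (a : ℤ) (ha : (T ^ a) ^ 2 = 1) : T ^ a = 1 ∨ T ^ a = T ^ (h : ℤ) := by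
  have ho := char_orderOf T hT
  rw [hq] at ho
  have h1 : T ^ (a * 2) = 1 := by rw [zpow_mul]; exact_mod_cast ha
  rw [← orderOf_dvd_iff_zpow_eq_one, ho] at h1
  obtain ⟨k, hk⟩ := h1
  have hk' : a = h * k := by push_cast at hk; linarith
  have hper : T ^ ((2 * h : ℕ) : ℤ) = 1 := by
    rw [← ho, zpow_natCast, pow_orderOf_eq_one]
  rcases Int.even_or_odd' k with ⟨m, rfl | rfl⟩
  · left
    rw [hk', show (h : ℤ) * (2 * m) = ((2 * h : ℕ) : ℤ) * m by push_cast; ring, zpow_mul, hper,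
      one_zpow]
  · right
    rw [hk', show (h : ℤ) * (2 * m + 1) = ((2 * h : ℕ) : ℤ) * m + h by push_cast; ring, zpow_add,
      zpow_mul, hper, one_zpow, one_mul]

lemma jacobi_dup {F : Type*} [Field F] [Fintype F] [DecidableEq F] (hF : ringChar F ≠ 2)
    (χ : MulChar F ℂ) (hχ : χ ≠ 1) :
    χ 4 * jacobiSum χ χ =
      jacobiSum χ ((quadraticChar F).ringHomComp (Int.castRingHom ℂ)) := by
  have h2 : (2 : F) ≠ 0 := Ring.two_ne_zero hF
  have e1 : χ 4 * jacobiSum χ χ = ∑ x : F, χ (1 - x ^ 2) := by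
    rw [jacobiSum, mul_sum]
    have hb : Function.Bijective (fun x : F => 2 * x - 1) :=
      ((Equiv.mulLeft₀ (2 : F) h2).trans (Equiv.subRight 1)).bijective
    rw [← hb.sum_comp (fun x : F => χ (1 - x ^ 2))]
    refine sum_congr rfl fun x _ => ?_
    rw [← map_mul, ← map_mul]
    congr 1
    ring
  have e2 : ∑ x : F, χ (1 - x ^ 2) =
      ∑ u : F, ((quadraticChar F u : ℂ) + 1) * χ (1 - u) := by
    rw [← sum_fiberwise (univ : Finset F) (fun x : F => x ^ 2)]
    refine sum_congr rfl fun u _ => ?_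
    have hc := quadraticChar_card_sqrts hF u
    rw [sum_congr rfl (g := fun _ => χ (1 - u))]
    · rw [sum_const, nsmul_eq_mul]
      congr 1
      have : ({x : F | x ^ 2 = u} : Set F).toFinset = univ.filter (fun x : F => x ^ 2 = u) := by
        ext; simp
      rw [this] at hc
      exact_mod_cast hc
    · intro x hx
      rw [(mem_filter.mp hx).2]
  have e3 : ∑ u : F, χ (1 - u) = 0 := by
    rw [← MulChar.sum_eq_zero_of_ne_one hχ]
    exact (Equiv.subLeft (1 : F)).sum_comp (fun x => χ x)
  rw [e1, e2, jacobiSum_comm, jacobiSum]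
  simp only [add_mul, one_mul, sum_add_distrib, e3, add_zero]
  rfl

theorem dh_two {F : Type*} [Field F] [Fintype F] [DecidableEq F] (hF : ringChar F ≠ 2)
    (ψ : AddChar F ℂ) (hψ : ψ.IsPrimitive) (χ φ : MulChar F ℂ)
    (hφ : φ = (quadraticChar F).ringHomComp (Int.castRingHom ℂ)) (hφ1 : φ ≠ 1)
    (hφ2 : φ * φ = 1) (h : χ * χ ≠ 1) :
    gaussSum (χ * χ) ψ * gaussSum φ ψ = gaussSum χ ψ * gaussSum (χ * φ) ψ * χ 4 := by
  have hcard : (Fintype.card F : ℂ) ≠ 0 := by exact_mod_cast Fintype.card_ne_zero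
  have hχ : χ ≠ 1 := by rintro rfl; simp at h
  have hχφ : χ * φ ≠ 1 := by
    intro h'
    have : χ = φ := by rw [eq_inv_of_mul_eq_one_left h', inv_eq_of_mul_eq_one_left hφ2]
    rw [this] at h
    exact h hφ2
  have hJ := jacobi_dup hF χ hχ
  rw [← hφ] at hJ
  have a1 := jacobiSum_mul_nontrivial h ψ
  have a2 := jacobiSum_mul_nontrivial hχφ ψ
  have hg := gaussSum_ne_zero_of_nontrivial hcard hχ hψ
  apply mul_left_cancel₀ hg
  linear_combination (-gaussSum (χ * χ) ψ) * a2 - gaussSum (χ * φ) ψ * gaussSum (χ*χ) ψ * hJ + gaussSum (χ * φ) ψ * χ 4 * a1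

theorem stmt14 {p : ℕ} [hp : Fact p.Prime] (hp2 : p ≠ 2) {F : Type*} [Field F] [Fintype F]
    [Algebra (ZMod p) F] (hq : Fintype.card F % 4 = 1) (T : MulChar F ℂ) (hT : ∀ χ : MulChar F ℂ, ∃ n : ℕ, χ = T ^ n) (l : ℤ) :
    GG p T (2 * l + (((Fintype.card F - 1) / 2 : ℕ) : ℤ)) =
      GG p T (l + (((Fintype.card F - 1) / 4 : ℕ) : ℤ)) * GG p T (l + (((3 * (Fintype.card F - 1)) / 4 : ℕ) : ℤ)) *
        (T ^ (l - (((Fintype.card F - 1) / 4 : ℕ) : ℤ))) 4 / GG p T (((Fintype.card F - 1) / 2 : ℕ) : ℤ) := by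
  classical
  obtain ⟨k, hk⟩ : ∃ k, Fintype.card F = 4 * k + 1 := ⟨Fintype.card F / 4, by omega⟩
  have hk1 : (Fintype.card F - 1) / 2 = 2 * k := by omega
  have hk2 : (Fintype.card F - 1) / 4 = k := by omega
  have hk3 : (3 * (Fintype.card F - 1)) / 4 = 3 * k := by omega
  rw [hk1, hk2, hk3]
  have hF : ringChar F ≠ 2 := by
    intro h
    have := FiniteField.even_card_of_char_two h
    omega
  have hcard : (Fintype.card F : ℂ) ≠ 0 := by exact_mod_cast Fintype.card_ne_zero
  have hψ := theta_primitive p F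
  have hc1 : Fintype.card F - 1 = 2 * (2 * k) := by omega
  obtain ⟨φ, hφ⟩ : ∃ φ : MulChar F ℂ,
    φ = (quadraticChar F).ringHomComp (Int.castRingHom ℂ) := ⟨_, rfl⟩
  have hφ1 : φ ≠ 1 := by
    rw [hφ]
    obtain ⟨a, ha⟩ := quadraticChar_exists_neg_one' hF
    intro h
    have h' : (Int.castRingHom ℂ) (quadraticChar F a) = (1 : MulChar F ℂ) a := by
      rw [← h]; rfl
    rw [ha, MulChar.one_apply_coe] at h'
    norm_num at h'
  have hφ2 : φ ^ 2 = 1 := by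
    rw [hφ]
    exact ((quadraticChar_isQuadratic F).comp _).sq_eq_one
  have hφT : φ = T ^ ((2 * k : ℕ) : ℤ) := by
    obtain ⟨n, hn⟩ := hT φ
    have hn' : φ = T ^ (n : ℤ) := by rw [hn, zpow_natCast]
    rcases char_sq_one T hT hc1 n (by rw [← hn', hφ2]) with h | h
    · exact absurd (hn'.trans h) hφ1
    · exact hn'.trans h
  have h2 : (2 : F) ≠ 0 := Ring.two_ne_zero hF
  have hφ4 : φ 4 = 1 := by
    have : (4 : F) = 2 * 2 := by norm_num
    rw [this, map_mul, ← MulChar.mul_apply, ← sq, hφ2, MulChar.one_apply h2.isUnit]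
  have hφφ : φ * φ = 1 := by rw [← sq, hφ2]
  obtain ⟨χ, hχ⟩ : ∃ χ : MulChar F ℂ, χ = T ^ (l + (k : ℤ)) := ⟨_, rfl⟩
  have s1 : T ^ (2 * l + ((2 * k : ℕ) : ℤ)) = χ * χ := by
    rw [hχ, ← zpow_add]; congr 1; push_cast; ring
  have s2 : T ^ (l + ((3 * k : ℕ) : ℤ)) = χ * φ := by
    rw [hχ, hφT, ← zpow_add]; congr 1; push_cast; ring
  have s3 : T ^ (l - (k : ℤ)) = χ * φ := by
    rw [← mul_one (T ^ (l - (k : ℤ))), ← hφφ, ← mul_assoc]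
    congr 1
    rw [hχ, hφT, ← zpow_add]; congr 1; push_cast; ring
  have hg := gaussSum_ne_zero_of_nontrivial hcard hφ1 hψ
  unfold GG
  rw [s1, s2, s3, ← hφT, ← hχ, eq_div_iff hg, MulChar.mul_apply, hφ4, mul_one]
  by_cases h : χ * χ = 1
  · rw [h]
    have h4 : IsUnit (4 : F) := by
      have : (4 : F) = 2 * 2 := by norm_num
      rw [this]; exact (mul_ne_zero h2 h2).isUnit
    rcases char_sq_one T hT hc1 (l + k) (by rw [← hχ, sq, h]) with h' | h'
    · rw [← hχ] at h'
      rw [h', one_mul, MulChar.one_apply h4, mul_one]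
    · rw [← hχ, ← hφT] at h'
      rw [h', hφφ, hφ4, mul_one, mul_comm]
  · exact dh_two hF _ hψ χ φ hφ hφ1 hφφ h
end
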